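/- Any measure of degree of stochastic dominance δ on a Polish space with closed partial order satisfying Axioms 1 and 2 equals τ, where τ(μ, ν) is the maximal probability of X ⪯ Y over couplings of (μ, ν). -/

import Mathlib

open MeasureTheory

/-- Stochastic dominance for finite measures. -/
def StochDom {S : Type*} [MeasurableSpace S] [Preorder S] (μ ν : Measure S) : Prop :=
  μ Set.univ = ν Set.univ ∧
    ∀ h : S → ℝ, Measurable h → Monotone h → (∃ C, ∀ x, |h x| ≤ C) →
      ∫ x, h x ∂μ ≤ ∫ x, h x ∂ν

section

open Set Filter Topology ENNReal

/-- An integer rounding of the transport problem, solved by Hall's marriage theorem. -/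
lemma exists_approx_transport {ι : Type*} [Fintype ι] {a b : ι → ℝ} (ha : ∀ i, 0 ≤ a i)
    (r : ι → ι → Prop)
    (hall : ∀ A B : Finset ι, (∀ i ∈ A, ∀ j, r i j → j ∈ B) → ∑ i ∈ A, a i ≤ ∑ j ∈ B, b j)
    {N : ℕ} (hN : 0 < N) :
    ∃ x : ι → ι → ℝ, (∀ i j, 0 ≤ x i j) ∧ (∀ i j, ¬ r i j → x i j = 0) ∧
      (∀ i, ∑ j, x i j ≤ a i) ∧ (∀ i, a i ≤ ∑ j, x i j + 1 / N) ∧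
      ∀ j, ∑ i, x i j ≤ b j + 1 / N := by
  classical
  have hN' : (0 : ℝ) < N := by exact_mod_cast hN
  have hb : ∀ j, 0 ≤ b j := fun j ↦ by simpa using hall ∅ {j} (by simp)
  obtain ⟨f, hf, hr⟩ := (Fintype.all_card_le_filter_rel_iff_exists_injective
    (α := Σ i, Fin ⌊N * a i⌋₊) (β := Σ j, Fin ⌈N * b j⌉₊) (fun p q ↦ r p.1 q.1)).1 <| by
      intro A
      set I := A.image Sigma.fst
      set J : Finset ι := {j | ∃ i ∈ I, r i j}
      have h1 : A.card ≤ ∑ i ∈ I, ⌊N * a i⌋₊ := by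
        calc A.card ≤ (I.sigma fun i ↦ (Finset.univ : Finset (Fin ⌊N * a i⌋₊))).card :=
              Finset.card_le_card fun p hp ↦ by
                simpa only [Finset.mem_sigma, Finset.mem_univ, and_true] using
                  Finset.mem_image_of_mem Sigma.fst hp
          _ = _ := by simp
      have h2 : ∑ j ∈ J, ⌈N * b j⌉₊ ≤
          (Finset.univ.filter fun q : Σ j, Fin ⌈N * b j⌉₊ ↦ ∃ p ∈ A, r p.1 q.1).card := by
        calc _ = (J.sigma fun j ↦ (Finset.univ : Finset (Fin ⌈N * b j⌉₊))).card := by simp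
          _ ≤ _ := Finset.card_le_card fun q hq ↦ by
                simp only [Finset.mem_sigma, J, I, Finset.mem_filter, Finset.mem_image,
                  Finset.mem_univ, true_and, and_true] at hq ⊢
                obtain ⟨_, ⟨p, hp, rfl⟩, h⟩ := hq
                exact ⟨p, hp, h⟩
      refine h1.trans (le_trans ?_ h2)
      have : (∑ i ∈ I, ⌊N * a i⌋₊ : ℝ) ≤ ∑ j ∈ J, (⌈N * b j⌉₊ : ℝ) := by
        calc (∑ i ∈ I, ⌊N * a i⌋₊ : ℝ) ≤ ∑ i ∈ I, N * a i :=
              Finset.sum_le_sum fun i _ ↦ Nat.floor_le (mul_nonneg hN'.le (ha i))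
          _ ≤ ∑ j ∈ J, N * b j := by
              rw [← Finset.mul_sum, ← Finset.mul_sum]
              refine mul_le_mul_of_nonneg_left (hall I J fun i hi j h ↦ ?_) hN'.le
              simpa [J] using ⟨i, hi, h⟩
          _ ≤ _ := Finset.sum_le_sum fun j _ ↦ Nat.le_ceil _
      exact_mod_cast this
  let c : ι → ι → ℕ := fun i j ↦ (Finset.univ.filter fun k ↦ (f ⟨i, k⟩).1 = j).card
  have hrow : ∀ i, ∑ j, c i j = ⌊N * a i⌋₊ := fun i ↦ by
    have := Finset.card_eq_sum_card_fiberwise (f := fun k ↦ (f ⟨i, k⟩).1)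
      (s := Finset.univ) (t := Finset.univ) (by simp)
    simpa using this.symm
  have hcol : ∀ j, ∑ i, c i j ≤ ⌈N * b j⌉₊ := fun j ↦ by
    calc ∑ i, c i j = (Finset.univ.filter fun p ↦ (f p).1 = j).card := by
          rw [← Finset.card_sigma]
          congr 1
          ext ⟨i, k⟩
          simp
      _ ≤ (Finset.univ.filter fun q : Σ j, Fin ⌈N * b j⌉₊ ↦ q.1 = j).card :=
          Finset.card_le_card_of_injOn f (fun p hp ↦ by simpa using hp) hf.injOn
      _ = (({j} : Finset ι).sigma fun j ↦ (Finset.univ : Finset (Fin ⌈N * b j⌉₊))).card := by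
          congr 1
          ext ⟨i, k⟩
          simp
      _ = _ := by simp
  refine ⟨fun i j ↦ c i j / N, fun i j ↦ by positivity, fun i j h ↦ ?_, fun i ↦ ?_, fun i ↦ ?_,
    fun j ↦ ?_⟩
  · have : c i j = 0 := by
      simp only [c, Finset.card_eq_zero, Finset.filter_eq_empty_iff]
      rintro k - rfl
      exact h (hr ⟨i, k⟩)
    simp [this]
  · rw [← Finset.sum_div, div_le_iff₀ hN', ← Nat.cast_sum, hrow, mul_comm (a i)]
    exact Nat.floor_le (mul_nonneg hN'.le (ha i))
  · rw [← Finset.sum_div, ← add_div, le_div_iff₀ hN', ← Nat.cast_sum, hrow, mul_comm]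
    exact (Nat.lt_floor_add_one _).le
  · have h := (Nat.ceil_lt_add_one (mul_nonneg hN'.le (hb j))).le
    have h' : ((∑ i, c i j : ℕ) : ℝ) ≤ ⌈N * b j⌉₊ := by exact_mod_cast hcol j
    rw [← Finset.sum_div, div_le_iff₀ hN', add_mul, ← Nat.cast_sum, one_div_mul_cancel hN'.ne',
      mul_comm (b j)]
    exact h'.trans h

/-- The finite transport problem is solvable under Hall's condition. -/
lemma exists_transport {ι : Type*} [Fintype ι] {a b : ι → ℝ} (ha : ∀ i, 0 ≤ a i)
    (r : ι → ι → Prop)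
    (hall : ∀ A B : Finset ι, (∀ i ∈ A, ∀ j, r i j → j ∈ B) → ∑ i ∈ A, a i ≤ ∑ j ∈ B, b j)
    (hab : ∑ i, a i = ∑ j, b j) :
    ∃ x : ι → ι → ℝ, (∀ i j, 0 ≤ x i j) ∧ (∀ i j, ¬ r i j → x i j = 0) ∧
      (∀ i, ∑ j, x i j = a i) ∧ ∀ j, ∑ i, x i j = b j := by
  let T : ℕ → Set (ι → ι → ℝ) := fun n ↦ {x | (∀ i j, 0 ≤ x i j) ∧ (∀ i j, ¬ r i j → x i j = 0) ∧
      (∀ i, ∑ j, x i j ≤ a i) ∧ (∀ i, a i ≤ ∑ j, x i j + 1 / (n + 1 : ℕ)) ∧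
      ∀ j, ∑ i, x i j ≤ b j + 1 / (n + 1 : ℕ)}
  have hT : ∀ n, IsClosed (T n) := fun n ↦ by
    simp only [T, ofPred_and, ofPred_forall]
    refine .inter ?_ (.inter ?_ (.inter ?_ (.inter ?_ ?_)))
    · exact isClosed_iInter fun i ↦ isClosed_iInter fun j ↦
        isClosed_le continuous_const (by fun_prop)
    · exact isClosed_iInter fun i ↦ isClosed_iInter fun j ↦ isClosed_iInter fun _ ↦
        isClosed_eq (by fun_prop) continuous_const
    · exact isClosed_iInter fun i ↦ isClosed_le (by fun_prop) (by fun_prop)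
    · exact isClosed_iInter fun i ↦ isClosed_le (by fun_prop) (by fun_prop)
    · exact isClosed_iInter fun i ↦ isClosed_le (by fun_prop) (by fun_prop)
  have hcpt : IsCompact (T 0) := by
    refine (isCompact_Icc (a := (0 : ι → ι → ℝ)) (b := fun i _ ↦ a i)).of_isClosed_subset (hT 0) ?_
    rintro x ⟨h0, -, h1, -⟩
    exact ⟨fun i j ↦ h0 i j, fun i j ↦
      (Finset.single_le_sum (fun j _ ↦ h0 i j) (Finset.mem_univ j)).trans (h1 i)⟩
  obtain ⟨x, hx⟩ := IsCompact.nonempty_iInter_of_sequence_nonempty_isCompact_isClosed T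
    (fun n x ⟨h0, hr, h1, h2, h3⟩ ↦ by
      have : (1 / (n + 1 + 1 : ℕ) : ℝ) ≤ 1 / (n + 1 : ℕ) := by gcongr; simp
      exact ⟨h0, hr, h1, fun i ↦ (h2 i).trans (by gcongr), fun j ↦ (h3 j).trans (by gcongr)⟩)
    (fun n ↦ exists_approx_transport ha r hall n.succ_pos) hcpt hT
  rw [mem_iInter] at hx
  have hlim : ∀ c : ℝ, Tendsto (fun n : ℕ ↦ c + 1 / (n + 1 : ℕ)) atTop (𝓝 c) := fun c ↦ by
    simpa using tendsto_one_div_add_atTop_nhds_zero_nat.const_add c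
  have hrow : ∀ i, ∑ j, x i j = a i := fun i ↦ ((hx 0).2.2.1 i).antisymm <|
    ge_of_tendsto' (hlim _) fun n ↦ (hx n).2.2.2.1 i
  have hcol : ∀ j, ∑ i, x i j ≤ b j := fun j ↦
    ge_of_tendsto' (hlim _) fun n ↦ (hx n).2.2.2.2 j
  refine ⟨x, (hx 0).1, (hx 0).2.1, hrow, fun j ↦ ?_⟩
  refine (Finset.sum_eq_sum_iff_of_le fun j _ ↦ hcol j).1 ?_ j (Finset.mem_univ j)
  rw [Finset.sum_comm, ← hab]
  exact Finset.sum_congr rfl fun i _ ↦ hrow i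

lemma sum_smul_cond_fiber {S ι : Type*} [MeasurableSpace S] [Fintype ι] [MeasurableSpace ι]
    [MeasurableSingletonClass ι] (μ : Measure S) [IsFiniteMeasure μ] {g : S → ι}
    (hg : Measurable g) :
    ∑ i, μ (g ⁻¹' {i}) • ProbabilityTheory.cond μ (g ⁻¹' {i}) = μ := by
  ext t ht
  have : ∀ i, μ (g ⁻¹' {i}) • ProbabilityTheory.cond μ (g ⁻¹' {i}) =
      μ.restrict (g ⁻¹' {i}) := fun i ↦ by
    rcases eq_or_ne (μ (g ⁻¹' {i})) 0 with h | h
    · simp [Measure.restrict_eq_zero.2 h, h]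
    · rw [ProbabilityTheory.cond, smul_smul, ENNReal.mul_inv_cancel h (measure_ne_top _ _),
        one_smul]
  simp_rw [this, Measure.finsetSum_apply]
  simp_rw [Measure.restrict_apply ht, inter_comm t, ← Measure.restrict_apply' ht]
  rw [sum_measure_preimage_singleton _ fun i _ ↦ hg (measurableSet_singleton i)]
  simp

/-- A transport plan between the cells of a finite partition lifts to a coupling. -/
lemma exists_coupling_of_transport {S ι : Type*} [MeasurableSpace S] [Fintype ι]
    [MeasurableSpace ι] [MeasurableSingletonClass ι] (μ ν : Measure S) [IsFiniteMeasure μ]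
    [IsFiniteMeasure ν] {g : S → ι} (hg : Measurable g) {x : ι → ι → ℝ≥0∞}
    (hrow : ∀ i, ∑ j, x i j = μ (g ⁻¹' {i})) (hcol : ∀ j, ∑ i, x i j = ν (g ⁻¹' {j})) :
    ∃ π : Measure (S × S), π.map Prod.fst = μ ∧ π.map Prod.snd = ν ∧
      ∀ r : ι → ι → Prop, (∀ i j, ¬ r i j → x i j = 0) → π {p | ¬ r (g p.1) (g p.2)} = 0 := by
  have hμ : ∀ i j, x i j ≠ 0 → IsProbabilityMeasure (ProbabilityTheory.cond μ (g ⁻¹' {i})) :=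
    fun i j h ↦ ProbabilityTheory.cond_isProbabilityMeasure fun h0 ↦ h <|
      Finset.sum_eq_zero_iff.1 ((hrow i).trans h0) j (Finset.mem_univ j)
  have hν : ∀ i j, x i j ≠ 0 → IsProbabilityMeasure (ProbabilityTheory.cond ν (g ⁻¹' {j})) :=
    fun i j h ↦ ProbabilityTheory.cond_isProbabilityMeasure fun h0 ↦ h <|
      Finset.sum_eq_zero_iff.1 ((hcol j).trans h0) i (Finset.mem_univ i)
  refine ⟨∑ i, ∑ j, x i j • (ProbabilityTheory.cond μ (g ⁻¹' {i})).prod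
    (ProbabilityTheory.cond ν (g ⁻¹' {j})), ?_, ?_, fun r hr ↦ ?_⟩
  · conv_rhs => rw [← sum_smul_cond_fiber μ hg]
    rw [Measure.map_finset_sum measurable_fst.aemeasurable]
    refine Finset.sum_congr rfl fun i _ ↦ ?_
    rw [Measure.map_finset_sum measurable_fst.aemeasurable, ← hrow, Finset.sum_smul]
    refine Finset.sum_congr rfl fun j _ ↦ ?_
    rw [Measure.map_smul, Measure.map_fst_prod]
    by_cases h : x i j = 0
    · simp [h]
    · have := hν i j h
      simp
  · conv_rhs => rw [← sum_smul_cond_fiber ν hg]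
    rw [Finset.sum_comm, Measure.map_finset_sum measurable_snd.aemeasurable]
    refine Finset.sum_congr rfl fun j _ ↦ ?_
    rw [Measure.map_finset_sum measurable_snd.aemeasurable, ← hcol, Finset.sum_smul]
    refine Finset.sum_congr rfl fun i _ ↦ ?_
    rw [Measure.map_smul, Measure.map_snd_prod]
    by_cases h : x i j = 0
    · simp [h]
    · have := hμ i j h
      simp
  · simp only [Measure.finsetSum_apply, Measure.smul_apply, smul_eq_mul]
    refine Finset.sum_eq_zero fun i _ ↦ Finset.sum_eq_zero fun j _ ↦ ?_
    by_cases h : r i j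
    · have h1 : ∀ᵐ p ∂(ProbabilityTheory.cond μ (g ⁻¹' {i})).prod
          (ProbabilityTheory.cond ν (g ⁻¹' {j})), g p.1 = i ∧ g p.2 = j :=
        (Measure.quasiMeasurePreserving_fst.ae (ProbabilityTheory.ae_cond_mem
          (hg (measurableSet_singleton i)))).and
        (Measure.quasiMeasurePreserving_snd.ae (ProbabilityTheory.ae_cond_mem
          (hg (measurableSet_singleton j))))
      refine mul_eq_zero_of_right _ (ae_iff.1 (h1.mono fun p hp ↦ ?_))
      rwa [hp.1, hp.2]
    · simp [hr i j h]

/-- The up-set generated by a compact set is closed. -/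
lemma IsCompact.isClosed_upperSet {S : Type*} [TopologicalSpace S] [Preorder S]
    [OrderClosedTopology S] {K : Set S} (hK : IsCompact K) :
    IsClosed {y | ∃ x ∈ K, x ≤ y} := by
  have := isCompact_iff_compactSpace.1 hK
  have h : IsClosed {p : K × S | (p.1 : S) ≤ p.2} :=
    isClosed_le (by fun_prop) (by fun_prop)
  convert isClosedMap_snd_of_compactSpace _ h using 1
  ext y
  simp

lemma StochDom.measure_le_of_isCompact {S : Type*} [TopologicalSpace S] [MeasurableSpace S]
    [BorelSpace S] [Preorder S] [OrderClosedTopology S] {μ ν : Measure S} [IsFiniteMeasure μ]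
    [IsFiniteMeasure ν] (h : StochDom μ ν) {K : Set S} (hK : IsCompact K) :
    μ K ≤ ν {y | ∃ x ∈ K, x ≤ y} := by
  set U := {y | ∃ x ∈ K, x ≤ y}
  have hU : MeasurableSet U := hK.isClosed_upperSet.measurableSet
  have key := h.2 (U.indicator 1) (measurable_one.indicator hU) (fun a b hab ↦ by
    by_cases ha : a ∈ U
    · have hb : b ∈ U := ha.imp fun x hx ↦ ⟨hx.1, hx.2.trans hab⟩
      simp [ha, hb]
    · rw [indicator_of_notMem ha]
      exact indicator_nonneg (fun _ _ ↦ zero_le_one) b) ⟨1, fun x ↦ by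
      by_cases hx : x ∈ U <;> simp [hx]⟩
  rw [integral_indicator_one hU, integral_indicator_one hU, measureReal_def, measureReal_def,
    ENNReal.toReal_le_toReal (measure_ne_top _ _) (measure_ne_top _ _)] at key
  have hKU : K ⊆ U := fun x hx ↦ ⟨x, hx, le_rfl⟩
  exact (measure_mono hKU).trans key

/-- A finitely discretized form of Strassen's theorem. -/
lemma exists_coupling_cells {S ι : Type*} [TopologicalSpace S] [PolishSpace S]
    [MeasurableSpace S] [BorelSpace S] [LE S] {μ ν : Measure S} [IsFiniteMeasure μ]
    [IsFiniteMeasure ν] (huniv : μ univ = ν univ)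
    (hle : ∀ K : Set S, IsCompact K → μ K ≤ ν {y | ∃ x ∈ K, x ≤ y})
    [Fintype ι] [MeasurableSpace ι] [MeasurableSingletonClass ι] {g : S → ι} (hg : Measurable g) :
    ∃ π : Measure (S × S), π.map Prod.fst = μ ∧ π.map Prod.snd = ν ∧
      π {p | ¬ ∃ x y, g x = g p.1 ∧ g y = g p.2 ∧ x ≤ y} = 0 := by
  have hms : ∀ y, MeasurableSet (g ⁻¹' {y}) := fun y ↦ hg (measurableSet_singleton y)
  have hsum : ∀ (ρ : Measure S) [IsFiniteMeasure ρ] (A : Finset ι),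
      ∑ i ∈ A, ρ.real (g ⁻¹' {i}) = ρ.real (g ⁻¹' A) := fun ρ _ A ↦
    sum_measureReal_preimage_singleton A fun y _ ↦ hms y
  obtain ⟨x, h0, hr, hrow, hcol⟩ := exists_transport (a := fun i ↦ μ.real (g ⁻¹' {i}))
    (b := fun i ↦ ν.real (g ⁻¹' {i})) (fun i ↦ measureReal_nonneg)
    (fun i j ↦ ∃ x y, g x = i ∧ g y = j ∧ x ≤ y) (fun A B hAB ↦ by
      rw [hsum, hsum, measureReal_def, measureReal_def,
        ENNReal.toReal_le_toReal (measure_ne_top _ _) (measure_ne_top _ _)]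
      have hA : MeasurableSet (g ⁻¹' A) := hg A.measurableSet
      rw [hA.measure_eq_iSup_isCompact]
      refine iSup₂_le fun K hKA ↦ iSup_le fun hK ↦ (hle K hK).trans (measure_mono ?_)
      rintro y ⟨x, hx, hxy⟩
      exact hAB _ (hKA hx) _ ⟨x, y, rfl, rfl, hxy⟩)
    (by rw [hsum, hsum]; simp [measureReal_def, huniv])
  obtain ⟨π, h1, h2, h3⟩ := exists_coupling_of_transport μ ν hg
    (x := fun i j ↦ ENNReal.ofReal (x i j))
    (fun i ↦ by rw [← ENNReal.ofReal_sum_of_nonneg fun j _ ↦ h0 i j, hrow, ofReal_measureReal])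
    (fun j ↦ by rw [← ENNReal.ofReal_sum_of_nonneg fun i _ ↦ h0 i j, hcol, ofReal_measureReal])
  exact ⟨π, h1, h2, h3 (fun i j ↦ ∃ x y, g x = i ∧ g y = j ∧ x ≤ y) fun i j h ↦ by simp [hr i j h]⟩

/-- Points of a separable metric space can be classified into finitely many cells, of which all but
the last have small diameter, and the last has small measure. -/
lemma exists_measurable_cells {S : Type*} [PseudoMetricSpace S] [SecondCountableTopology S]
    [MeasurableSpace S] [OpensMeasurableSpace S] (μ : Measure S) [IsFiniteMeasure μ] {ε : ℝ}
    (hε : 0 < ε) {η : ℝ≥0∞} (hη : 0 < η) :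
    ∃ (g : S → ℕ) (n : ℕ), Measurable g ∧ (∀ x y, g x = g y → dist x y < ε) ∧
      μ {x | n ≤ g x} < η := by
  classical
  rcases isEmpty_or_nonempty S with hS | hS
  · exact ⟨fun _ ↦ 0, 0, measurable_const, fun x ↦ hS.elim x, by
      rwa [Measure.eq_zero_of_isEmpty μ]⟩
  have hex : ∀ x : S, ∃ n, dist x (TopologicalSpace.denseSeq S n) < ε / 2 := fun x ↦
    (TopologicalSpace.denseRange_denseSeq S).exists_dist_lt x (half_pos hε)
  have hg : Measurable fun x ↦ Nat.find (hex x) := measurable_find hex fun k ↦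
    (isOpen_lt (by fun_prop) continuous_const).measurableSet
  have hlim : Tendsto (fun n ↦ μ {x | n ≤ Nat.find (hex x)}) atTop (𝓝 0) := by
    have := tendsto_measure_iInter_atTop (μ := μ) (s := fun n ↦ {x | n ≤ Nat.find (hex x)})
      (fun n ↦ (hg measurableSet_Ici).nullMeasurableSet)
      (fun m n hmn x hx ↦ hmn.trans hx) ⟨0, measure_ne_top _ _⟩
    have hempty : ⋂ n, {x | n ≤ Nat.find (hex x)} = ∅ := by
      refine eq_empty_of_forall_notMem fun x hx ↦ ?_
      exact absurd (mem_iInter.1 hx (Nat.find (hex x) + 1)) (Nat.not_succ_le_self _)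
    rwa [hempty, measure_empty] at this
  obtain ⟨n, hn⟩ := (hlim.eventually_lt_const hη).exists
  refine ⟨_, n, hg, fun x y hxy ↦ ?_, hn⟩
  have hx := Nat.find_spec (hex x)
  have hy := Nat.find_spec (hex y)
  rw [← hxy] at hy
  linarith [dist_triangle_right x y (TopologicalSpace.denseSeq S (Nat.find (hex x)))]

/-- An approximate form of Strassen's theorem. -/
lemma exists_coupling_cthickening {S : Type*} [MetricSpace S] [CompleteSpace S]
    [SecondCountableTopology S] [MeasurableSpace S] [BorelSpace S] [LE S] {μ ν : Measure S}
    [IsFiniteMeasure μ] [IsFiniteMeasure ν] (huniv : μ univ = ν univ)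
    (hle : ∀ K : Set S, IsCompact K → μ K ≤ ν {y | ∃ x ∈ K, x ≤ y}) {ε : ℝ} (hε : 0 < ε)
    {η : ℝ≥0∞} (hη : 0 < η) :
    ∃ π : Measure (S × S), π.map Prod.fst = μ ∧ π.map Prod.snd = ν ∧
      μ univ ≤ π (Metric.cthickening ε {p : S × S | p.1 ≤ p.2}) + η := by
  obtain ⟨g, n, hg, hdist, hn⟩ := exists_measurable_cells (μ + ν) hε hη
  let G : S → Fin (n + 1) := fun x ↦ ⟨min (g x) n, by omega⟩
  have hG : Measurable G :=
    (measurable_of_countable fun k : ℕ ↦ (⟨min k n, by omega⟩ : Fin (n + 1))).comp hg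
  obtain ⟨π, h1, h2, h3⟩ := exists_coupling_cells huniv hle hG
  refine ⟨π, h1, h2, ?_⟩
  have hms : MeasurableSet {x | n ≤ g x} := hg measurableSet_Ici
  have hcover : univ ⊆ Metric.cthickening ε {p : S × S | p.1 ≤ p.2} ∪
      {p | ¬ ∃ x y, G x = G p.1 ∧ G y = G p.2 ∧ x ≤ y} ∪
      (Prod.fst ⁻¹' {x | n ≤ g x} ∪ Prod.snd ⁻¹' {x | n ≤ g x}) := by
    rintro ⟨u, v⟩ -
    by_contra hcon
    simp only [mem_union, mem_ofPred_eq, mem_preimage, not_or, not_not, not_le] at hcon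
    obtain ⟨⟨hA, x, y, hx, hy, hxy⟩, hu, hv⟩ := hcon
    have hcell : ∀ a b, G a = G b → g b < n → g b = g a := fun a b hab hb ↦ by
      simp only [G, Fin.mk.injEq] at hab
      omega
    refine hA (Metric.mem_cthickening_of_dist_le (u, v) (x, y) ε _ hxy ?_)
    exact max_le (hdist _ _ (hcell _ _ hx hu)).le (hdist _ _ (hcell _ _ hy hv)).le
  calc μ univ = π univ := by rw [← h1, Measure.map_apply measurable_fst .univ, preimage_univ]
    _ ≤ _ := (measure_mono hcover).trans (measure_union_le _ _)
    _ ≤ (π (Metric.cthickening ε {p : S × S | p.1 ≤ p.2}) + 0) +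
        (μ {x | n ≤ g x} + ν {x | n ≤ g x}) := by
      refine add_le_add ((measure_union_le _ _).trans (by rw [h3])) ((measure_union_le _ _).trans ?_)
      rw [← Measure.map_apply measurable_fst hms, ← Measure.map_apply measurable_snd hms, h1, h2]
    _ ≤ _ := by
      rw [add_zero]
      gcongr
      exact hn.le

/-- **Strassen's theorem**: stochastic dominance is realized by a coupling supported on the
order relation. -/
theorem StochDom.exists_coupling {S : Type*} [TopologicalSpace S] [PolishSpace S]
    [MeasurableSpace S] [BorelSpace S] [Preorder S] [OrderClosedTopology S] {μ ν : Measure S}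
    [IsProbabilityMeasure μ] [IsProbabilityMeasure ν] (h : StochDom μ ν) :
    ∃ π : Measure (S × S), π.map Prod.fst = μ ∧ π.map Prod.snd = ν ∧
      π {p | p.1 ≤ p.2} = 1 := by
  let _ := TopologicalSpace.upgradeIsCompletelyMetrizable S
  set A : Set (S × S) := {p | p.1 ≤ p.2}
  have hA : IsClosed A := isClosed_le continuous_fst continuous_snd
  have happrox : ∀ n : ℕ, ∃ π : ProbabilityMeasure (S × S), π.toMeasure.map Prod.fst = μ ∧
      π.toMeasure.map Prod.snd = ν ∧
      1 ≤ π.toMeasure (Metric.cthickening (1 / (n + 1)) A) + (n + 1 : ℝ≥0∞)⁻¹ := fun n ↦ by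
    obtain ⟨π, h1, h2, h3⟩ := exists_coupling_cthickening h.1
      (fun K hK ↦ h.measure_le_of_isCompact hK) (Nat.one_div_pos_of_nat (α := ℝ) (n := n))
      (η := (n + 1 : ℝ≥0∞)⁻¹) (by simp)
    have : IsProbabilityMeasure π := ⟨by
      rw [← preimage_univ (f := Prod.fst), ← Measure.map_apply measurable_fst .univ, h1,
        measure_univ]⟩
    exact ⟨⟨π, this⟩, h1, h2, by simpa using h3⟩
  choose π h1 h2 h3 using happrox
  have hcpt : IsCompact (closure (range π)) := by
    refine isCompact_closure_of_isTightMeasureSet (.prodMk ?_ ?_)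
    · refine (isTightMeasureSet_singleton (μ := μ)).subset ?_
      rintro _ ⟨_, ⟨_, ⟨n, rfl⟩, rfl⟩, rfl⟩
      exact h1 n
    · refine (isTightMeasureSet_singleton (μ := ν)).subset ?_
      rintro _ ⟨_, ⟨_, ⟨n, rfl⟩, rfl⟩, rfl⟩
      exact h2 n
  obtain ⟨ρ, -, hρ⟩ := hcpt.ultrafilter_le_nhds ((hyperfilter ℕ).map π)
    (le_principal_iff.2 <| mem_map.2 <| univ_mem' fun n ↦ subset_closure (mem_range_self n))
  have hρ' : Tendsto π (hyperfilter ℕ) (𝓝 ρ) := hρ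
  have hmap : ∀ (f : S × S → S) (hf : Continuous f) (κ : Measure S) [IsProbabilityMeasure κ],
      (∀ n, (π n).toMeasure.map f = κ) → ρ.toMeasure.map f = κ := fun f hf κ _ hκ ↦ by
    have hlim := ProbabilityMeasure.tendsto_map_of_tendsto_of_continuous π ρ hρ' hf
    have hconst : ∀ n, (π n).map hf.measurable.aemeasurable =
        (⟨κ, ‹_›⟩ : ProbabilityMeasure S) := fun n ↦
      Subtype.ext (hκ n)
    simp only [hconst] at hlim
    have heq : ρ.map hf.measurable.aemeasurable = (⟨κ, ‹_›⟩ : ProbabilityMeasure S) :=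
      tendsto_nhds_unique hlim tendsto_const_nhds
    exact congrArg Subtype.val heq
  refine ⟨ρ, hmap _ continuous_fst μ h1, hmap _ continuous_snd ν h2, prob_le_one.antisymm ?_⟩
  have hthick : ∀ δ : ℝ, 0 < δ → 1 ≤ ρ.toMeasure (Metric.cthickening δ A) := fun δ hδ ↦ by
    refine le_trans ?_ (ProbabilityMeasure.limsup_measure_closed_le_of_tendsto hρ'
      (Metric.isClosed_cthickening (δ := δ) (E := A)))
    have hinv : Tendsto (fun n : ℕ ↦ 1 - (n + 1 : ℝ≥0∞)⁻¹) (hyperfilter ℕ) (𝓝 1) := by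
      have h0 : Tendsto (fun n : ℕ ↦ (n + 1 : ℝ≥0∞)⁻¹) atTop (𝓝 0) := by
        simpa using (tendsto_add_atTop_iff_nat 1).2 ENNReal.tendsto_inv_nat_nhds_zero
      have := ENNReal.Tendsto.sub tendsto_const_nhds h0 (.inl one_ne_top)
      rw [tsub_zero] at this
      exact this.mono_left Nat.hyperfilter_le_atTop
    rw [← hinv.limsup_eq]
    refine limsup_le_limsup ?_
    have hev : ∀ᶠ n : ℕ in atTop, 1 / (n + 1 : ℝ) < δ :=
      tendsto_one_div_add_atTop_nhds_zero_nat.eventually_lt_const hδ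
    filter_upwards [Nat.hyperfilter_le_atTop hev] with n hn
    exact tsub_le_iff_right.2 ((h3 n).trans (by gcongr; exact Metric.cthickening_mono hn.le _))
  refine ge_of_tendsto ((tendsto_measure_cthickening_of_isClosed
    ⟨1, one_pos, measure_ne_top _ _⟩ hA).mono_left (nhdsWithin_le_nhds (s := Ioi 0))) ?_
  filter_upwards [self_mem_nhdsWithin] with δ hδ using hthick δ hδ

/-- An order-supported coupling witnesses stochastic dominance between its marginals. -/
lemma stochDom_map_of_ae_le {S : Type*} [MeasurableSpace S] [Preorder S] {π : Measure (S × S)}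
    [IsFiniteMeasure π] (h : ∀ᵐ p ∂π, p.1 ≤ p.2) :
    StochDom (π.map Prod.fst) (π.map Prod.snd) := by
  refine ⟨by simp [Measure.map_apply measurable_fst .univ, Measure.map_apply measurable_snd .univ],
    fun f hf hmono ⟨C, hC⟩ ↦ ?_⟩
  have hfg : ∀ g : S × S → S, Measurable g → Integrable (fun p ↦ f (g p)) π := fun g hg ↦
    .of_bound (hf.comp hg).aestronglyMeasurable C (ae_of_all _ fun p ↦ hC _)
  rw [integral_map measurable_fst.aemeasurable hf.aestronglyMeasurable,
    integral_map measurable_snd.aemeasurable hf.aestronglyMeasurable]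
  exact integral_mono_ae (hfg _ measurable_fst) (hfg _ measurable_snd) (h.mono fun p hp ↦ hmono hp)

lemma StochDom.smul {S : Type*} [MeasurableSpace S] [Preorder S] {μ ν : Measure S}
    (h : StochDom μ ν) (c : ℝ≥0∞) : StochDom (c • μ) (c • ν) := by
  refine ⟨by simp [h.1], fun f hf hmono hb ↦ ?_⟩
  rw [integral_smul_measure, integral_smul_measure]
  exact smul_le_smul_of_nonneg_left (h.2 f hf hmono hb) ENNReal.toReal_nonneg

/-- Finite measures of equal mass have a coupling. -/
lemma exists_coupling_of_measure_univ_eq {S : Type*} [MeasurableSpace S] (μ ν : Measure S)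
    [IsFiniteMeasure μ] [IsFiniteMeasure ν] (h : μ univ = ν univ) :
    ∃ π : Measure (S × S), π.map Prod.fst = μ ∧ π.map Prod.snd = ν := by
  by_cases h0 : μ univ = 0
  · have h0' := h ▸ h0
    rw [Measure.measure_univ_eq_zero] at h0 h0'
    exact ⟨0, by simp [h0], by simp [h0']⟩
  · have hinv := ENNReal.inv_mul_cancel h0 (measure_ne_top _ _)
    refine ⟨(μ univ)⁻¹ • μ.prod ν, ?_, ?_⟩
    · rw [Measure.map_smul, Measure.map_fst_prod, smul_smul, ← h, hinv, one_smul]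
    · rw [Measure.map_smul, Measure.map_snd_prod, smul_smul, hinv, one_smul]

/-- Ordered components of two probability measures extend to a coupling ordering at least their
mass. -/
lemma StochDom.exists_coupling_of_le {S : Type*} [TopologicalSpace S] [PolishSpace S]
    [MeasurableSpace S] [BorelSpace S] [Preorder S] [OrderClosedTopology S]
    {μ ν μ' ν' : Measure S} [IsFiniteMeasure μ] [IsFiniteMeasure ν] [IsFiniteMeasure μ']
    [IsFiniteMeasure ν'] (hμν : μ univ = ν univ) (hμ : μ' ≤ μ) (hν : ν' ≤ ν)
    (h : StochDom μ' ν') :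
    ∃ π : Measure (S × S), π.map Prod.fst = μ ∧ π.map Prod.snd = ν ∧
      μ' univ ≤ π {p | p.1 ≤ p.2} := by
  obtain ⟨κ, hκ1, hκ2⟩ := exists_coupling_of_measure_univ_eq (μ - μ') (ν - ν') (by
    rw [Measure.sub_apply .univ hμ, Measure.sub_apply .univ hν, hμν, h.1])
  suffices ∃ π : Measure (S × S), π.map Prod.fst = μ' ∧ π.map Prod.snd = ν' ∧
      μ' univ ≤ π {p | p.1 ≤ p.2} by
    obtain ⟨π, h1, h2, h3⟩ := this
    refine ⟨κ + π, ?_, ?_, h3.trans ?_⟩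
    · rw [Measure.map_add _ _ measurable_fst, hκ1, h1, Measure.sub_add_cancel_of_le hμ]
    · rw [Measure.map_add _ _ measurable_snd, hκ2, h2, Measure.sub_add_cancel_of_le hν]
    · rw [Measure.add_apply]
      exact le_add_self
  by_cases h0 : μ' univ = 0
  · obtain ⟨π, h1, h2⟩ := exists_coupling_of_measure_univ_eq μ' ν' h.1
    exact ⟨π, h1, h2, by simp [h0]⟩
  have hinv := ENNReal.inv_mul_cancel h0 (measure_ne_top _ _)
  have hinv' := ENNReal.mul_inv_cancel h0 (measure_ne_top _ _)
  have : IsProbabilityMeasure ((μ' univ)⁻¹ • μ') := ⟨by simpa using hinv⟩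
  have : IsProbabilityMeasure ((μ' univ)⁻¹ • ν') := ⟨by simpa [← h.1] using hinv⟩
  obtain ⟨π, h1, h2, h3⟩ := (h.smul (μ' univ)⁻¹).exists_coupling
  refine ⟨μ' univ • π, ?_, ?_, ?_⟩
  · rw [Measure.map_smul, h1, smul_smul, hinv', one_smul]
  · rw [Measure.map_smul, h2, smul_smul, hinv', one_smul]
  · simp [h3]

/-- The mass that a coupling gives to a measurable set splits off as a mixture component. -/
lemma exists_mixture_of_coupling {S : Type*} [MeasurableSpace S] [Preorder S]
    (hA : MeasurableSet {p : S × S | p.1 ≤ p.2}) (π : Measure (S × S)) [IsProbabilityMeasure π]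
    (h0 : π {p | p.1 ≤ p.2} ≠ 0) (h1 : π {p | p.1 ≤ p.2}ᶜ ≠ 0) :
    ∃ πa πb : Measure (S × S), IsProbabilityMeasure πa ∧ IsProbabilityMeasure πb ∧
      (∀ᵐ p ∂πa, p.1 ≤ p.2) ∧
      π {p | p.1 ≤ p.2} • πa + (1 - π {p | p.1 ≤ p.2}) • πb = π := by
  refine ⟨ProbabilityTheory.cond π {p | p.1 ≤ p.2}, ProbabilityTheory.cond π {p | p.1 ≤ p.2}ᶜ,
    ProbabilityTheory.cond_isProbabilityMeasure h0,
    ProbabilityTheory.cond_isProbabilityMeasure h1, ProbabilityTheory.ae_cond_mem hA, ?_⟩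
  rw [← prob_compl_eq_one_sub hA, ProbabilityTheory.cond, ProbabilityTheory.cond, smul_smul,
    smul_smul, ENNReal.mul_inv_cancel h0 (measure_ne_top _ _),
    ENNReal.mul_inv_cancel h1 (measure_ne_top _ _), one_smul, one_smul,
    Measure.restrict_add_restrict_compl hA]

end

/-- Uniqueness: any measure of degree of stochastic dominance `δ` satisfying Axiom 1
(extraction of ordered components) and Axiom 2 (the mixture axiom) equals `τ`, the maximal
probability of `X ⪯ Y` over couplings of `(μ, ν)`. -/
theorem delta_eq_tau {S : Type*} [TopologicalSpace S] [PolishSpace S]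
    [MeasurableSpace S] [BorelSpace S] [PartialOrder S]
    (hcl : IsClosed {p : S × S | p.1 ≤ p.2})
    (δ : Measure S → Measure S → ℝ)
    (hrange : ∀ μ ν : Measure S, IsProbabilityMeasure μ → IsProbabilityMeasure ν →
      δ μ ν ∈ Set.Icc (0 : ℝ) 1)
    (hdom : ∀ μ ν : Measure S, IsProbabilityMeasure μ → IsProbabilityMeasure ν →
      StochDom μ ν → δ μ ν = 1)
    (hax1 : ∀ μ ν : Measure S, IsProbabilityMeasure μ → IsProbabilityMeasure ν →
      ∀ ε : ℝ, 0 < ε →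
        ∃ μ' ν' : Measure S, IsFiniteMeasure μ' ∧ IsFiniteMeasure ν' ∧
          μ' ≤ μ ∧ ν' ≤ ν ∧ StochDom μ' ν' ∧ δ μ ν ≤ (μ' Set.univ).toReal + ε)
    (hax2 : ∀ μa μb νa νb : Measure S,
      IsProbabilityMeasure μa → IsProbabilityMeasure μb →
      IsProbabilityMeasure νa → IsProbabilityMeasure νb →
      ∀ lam : ENNReal, lam ≤ 1 → StochDom μa νa →
        lam.toReal ≤ δ (lam • μa + (1 - lam) • μb) (lam • νa + (1 - lam) • νb))
    (μ ν : Measure S) [IsProbabilityMeasure μ] [IsProbabilityMeasure ν] :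
    δ μ ν = (⨆ (π : Measure (S × S))
      (_ : π.map Prod.fst = μ ∧ π.map Prod.snd = ν),
      π {p : S × S | p.1 ≤ p.2}).toReal := by
  have : OrderClosedTopology S := ⟨hcl⟩
  set τ := ⨆ (π : Measure (S × S)) (_ : π.map Prod.fst = μ ∧ π.map Prod.snd = ν),
    π {p : S × S | p.1 ≤ p.2}
  have hprob : ∀ π : Measure (S × S), π.map Prod.fst = μ → IsProbabilityMeasure π := fun π h ↦
    ⟨by rw [← Set.preimage_univ (f := Prod.fst), ← Measure.map_apply measurable_fst .univ, h,
      measure_univ]⟩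
  have hτ : τ ≤ 1 := iSup₂_le fun π h ↦ by
    have := hprob π h.1
    exact prob_le_one
  have hτtop : τ ≠ ⊤ := ne_top_of_le_ne_top ENNReal.one_ne_top hτ
  apply le_antisymm
  · refine le_of_forall_pos_le_add fun ε hε ↦ ?_
    obtain ⟨μ', ν', _, _, hμ, hν, hd, hle⟩ := hax1 μ ν ‹_› ‹_› ε hε
    obtain ⟨π, h1, h2, h3⟩ := hd.exists_coupling_of_le (by simp) hμ hν
    refine hle.trans (add_le_add_left (ENNReal.toReal_mono hτtop (h3.trans ?_)) ε)
    exact le_iSup₂_of_le π ⟨h1, h2⟩ le_rfl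
  · refine ENNReal.toReal_le_of_le_ofReal (hrange μ ν ‹_› ‹_›).1 (iSup₂_le fun π h ↦ ?_)
    have := hprob π h.1
    obtain ⟨h1, h2⟩ := h
    rw [ENNReal.le_ofReal_iff_toReal_le (measure_ne_top _ _) (hrange μ ν ‹_› ‹_›).1]
    by_cases h0 : π {p | p.1 ≤ p.2} = 0
    · simpa [h0] using (hrange μ ν ‹_› ‹_›).1
    by_cases hc : π {p | p.1 ≤ p.2}ᶜ = 0
    · have hd : StochDom μ ν := by
        rw [← h1, ← h2]
        exact stochDom_map_of_ae_le (ae_iff.2 hc)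
      rw [hdom μ ν ‹_› ‹_› hd]
      exact ENNReal.toReal_le_of_le_ofReal zero_le_one (by simpa using prob_le_one)
    obtain ⟨πa, πb, _, _, ha, hsum⟩ := exists_mixture_of_coupling hcl.measurableSet π h0 hc
    have key := hax2 (πa.map Prod.fst) (πb.map Prod.fst) (πa.map Prod.snd) (πb.map Prod.snd)
      (Measure.isProbabilityMeasure_map measurable_fst.aemeasurable)
      (Measure.isProbabilityMeasure_map measurable_fst.aemeasurable)
      (Measure.isProbabilityMeasure_map measurable_snd.aemeasurable)
      (Measure.isProbabilityMeasure_map measurable_snd.aemeasurable)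
      _ (prob_le_one (μ := π) (s := {p | p.1 ≤ p.2})) (stochDom_map_of_ae_le ha)
    simp only [← Measure.map_smul] at key
    rwa [← Measure.map_add _ _ measurable_fst, ← Measure.map_add _ _ measurable_snd, hsum, h1,
      h2] at key
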